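/- Let g ∈ F_q[x] have degree D ≥ 2 and let α be an element of an algebraic closure of F_q. Let G ∈ F_q[x] be the p-reduction of g, with g(x) = G(x)^{p^h}. Suppose g is not of the form a·x^{p^h} + b (a, b ∈ F_q) and there is no a in the algebraic closure with g(x) = a(x − α)^D + α. Then for every n ≥ 0, p^{n·h} ≤ ν*(g^{(n)}(x) − α) ≤ ν(g^{(n)}(x) − α) ≤ √(D/(D−1)) · (D(D−1))^{n/2} ≤ √2 · (D(D−1))^{n/2}. -/

import Mathlib

open Polynomial UniqueFactorizationMonoid
open scoped Classical

/-- The `n`-th compositional iterate of a polynomial `g`. -/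
noncomputable def iterPoly {K : Type*} [CommSemiring K] (g : Polynomial K) : ℕ → Polynomial K
  | 0 => X
  | n + 1 => g.comp (iterPoly g n)

/-- `P_n[f,g] = f(g^{(n)})`. -/
noncomputable def Pn {K : Type*} [CommSemiring K] (f g : Polynomial K) (n : ℕ) : Polynomial K :=
  f.comp (iterPoly g n)

/-- The finset of (normalized) monic irreducible factors of `P`. -/
noncomputable def irrFactors {K : Type*} [Field K] (P : Polynomial K) : Finset (Polynomial K) :=
  (normalizedFactors P).toFinset

/-- Number of distinct irreducible factors of `P`. -/
noncomputable def Nfac {K : Type*} [Field K] (P : Polynomial K) : ℕ := (irrFactors P).card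

/-- Degree of the squarefree part of `P`. -/
noncomputable def Dfac {K : Type*} [Field K] (P : Polynomial K) : ℕ :=
  ∑ r ∈ irrFactors P, r.natDegree

/-- Largest degree of an irreducible factor of `P`. -/
noncomputable def Mfac {K : Type*} [Field K] (P : Polynomial K) : ℕ :=
  (irrFactors P).sup natDegree

/-- Smallest degree of an irreducible factor of `P`. -/
noncomputable def mfac {K : Type*} [Field K] (P : Polynomial K) : ℕ :=
  sInf {d | ∃ r ∈ irrFactors P, r.natDegree = d}

/-- Largest multiplicity in the irreducible factorization of `P`. -/
noncomputable def Efac {K : Type*} [Field K] (P : Polynomial K) : ℕ :=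
  (irrFactors P).sup fun r => (normalizedFactors P).count r

/-- Smallest multiplicity in the irreducible factorization of `P`. -/
noncomputable def efac {K : Type*} [Field K] (P : Polynomial K) : ℕ :=
  sInf {e | ∃ r ∈ irrFactors P, (normalizedFactors P).count r = e}

/-- Largest multiplicity of a root of `P` in an algebraic closure. -/
noncomputable def nuMax {K : Type*} [Field K] (P : Polynomial K) : ℕ :=
  Efac (P.map (algebraMap K (AlgebraicClosure K)))

/-- Smallest multiplicity of a root of `P` in an algebraic closure. -/
noncomputable def nuMin {K : Type*} [Field K] (P : Polynomial K) : ℕ :=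
  efac (P.map (algebraMap K (AlgebraicClosure K)))

/-- The pair `(f, g)` is `p`-critical: `g = a x^{p^h} + b`. -/
def IsPCritical {K : Type*} [Field K] (p : ℕ) (_f g : Polynomial K) : Prop :=
  ∃ (h : ℕ) (a b : K), g = C a * X ^ p ^ h + C b

/-- The pair `(f, g)` is critical: `f = β (x-α)^{deg f}` and `g = γ (x-α)^{deg g} + α`. -/
def IsCritical {K : Type*} [Field K] (f g : Polynomial K) : Prop :=
  ∃ α β γ : K, f = C β * (X - C α) ^ f.natDegree ∧
    g = C γ * (X - C α) ^ g.natDegree + C α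

namespace Polynomial

section Field

variable {F : Type*} [Field F]

/-- The multiplicity of `γ` as a root of `q - q(γ)`. -/
noncomputable def ramIdx (q : F[X]) (γ : F) : ℕ :=
  rootMultiplicity γ (q - C (q.eval γ))

lemma sub_C_ne_zero_of_natDegree_pos {q : F[X]} (hq : 0 < q.natDegree) (c : F) :
    q - C c ≠ 0 := by
  intro h0
  rw [sub_eq_zero.mp h0, natDegree_C] at hq
  exact hq.ne rfl

lemma ramIdx_le_natDegree {q : F[X]} (hq : 0 < q.natDegree) (γ : F) :
    ramIdx q γ ≤ q.natDegree := by
  have h1 := natDegree_le_of_dvd (pow_rootMultiplicity_dvd (q - C (q.eval γ)) γ)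
    (sub_C_ne_zero_of_natDegree_pos hq _)
  rwa [natDegree_pow, natDegree_X_sub_C, mul_one, natDegree_sub_C] at h1

lemma ramIdx_comp {q P : F[X]} (hq : 0 < q.natDegree) (hP : 0 < P.natDegree) (β : F) :
    ramIdx (q.comp P) β = ramIdx q (P.eval β) * ramIdx P β := by
  obtain ⟨u, hu, hnd⟩ := exists_eq_pow_rootMultiplicity_mul_and_not_dvd
    (q - C (q.eval (P.eval β))) (sub_C_ne_zero_of_natDegree_pos hq _) (P.eval β)
  obtain ⟨v, hv, hvd⟩ := exists_eq_pow_rootMultiplicity_mul_and_not_dvd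
    (P - C (P.eval β)) (sub_C_ne_zero_of_natDegree_pos hP _) β
  have hcomp := congrArg (fun f : F[X] => f.comp P) hu
  change _ = ((X - C (P.eval β)) ^ ramIdx q (P.eval β) * u).comp P at hcomp
  change _ = (X - C β) ^ ramIdx P β * v at hv
  simp only [sub_comp, C_comp, mul_comp, pow_comp, X_comp] at hcomp
  rw [hv, mul_pow, ← pow_mul, mul_assoc, mul_comm (ramIdx P β)] at hcomp
  rw [dvd_iff_isRoot, IsRoot.def] at hnd hvd
  have hw : ¬ IsRoot (v ^ ramIdx q (P.eval β) * u.comp P) β := by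
    simp only [IsRoot.def, eval_mul, eval_pow, eval_comp]
    exact mul_ne_zero (pow_ne_zero _ hvd) hnd
  have hw0 : v ^ ramIdx q (P.eval β) * u.comp P ≠ 0 := by
    intro h0
    exact hw (by rw [h0]; simp)
  rw [ramIdx, eval_comp, hcomp, mul_comm, rootMultiplicity_mul_X_sub_C_pow hw0,
    rootMultiplicity_eq_zero hw, zero_add]

lemma exists_eq_of_ramIdx_eq_natDegree {q : F[X]} (hq : 0 < q.natDegree) {γ : F}
    (h : ramIdx q γ = q.natDegree) :
    ∃ a, a ≠ 0 ∧ q = C a * (X - C γ) ^ q.natDegree + C (q.eval γ) := by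
  obtain ⟨u, hu⟩ := pow_rootMultiplicity_dvd (q - C (q.eval γ)) γ
  change _ = _ ^ ramIdx q γ * _ at hu
  have h0 := sub_C_ne_zero_of_natDegree_pos hq (q.eval γ)
  have hu0 : u ≠ 0 := by
    rintro rfl
    exact h0 (by rw [hu, mul_zero])
  have hdeg := congrArg natDegree hu
  rw [natDegree_sub_C, natDegree_mul (pow_ne_zero _ (X_sub_C_ne_zero γ)) hu0, natDegree_pow,
    natDegree_X_sub_C, h, mul_one] at hdeg
  obtain ⟨a, rfl⟩ := natDegree_eq_zero.mp (show u.natDegree = 0 by lia)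
  refine ⟨a, fun ha => hu0 (by rw [ha, C_0]), ?_⟩
  rw [h] at hu
  rw [mul_comm, ← hu, sub_add_cancel]

lemma le_ramIdx_pow_char_pow {p : ℕ} [Fact p.Prime] [CharP F p] {G : F[X]} {h : ℕ}
    (hG : 0 < (G ^ p ^ h).natDegree) (γ : F) : p ^ h ≤ ramIdx (G ^ p ^ h) γ := by
  rw [ramIdx, le_rootMultiplicity_iff (sub_C_ne_zero_of_natDegree_pos hG _), eval_pow, C_pow,
    ← sub_pow_char_pow]
  exact pow_dvd_pow_of_dvd (dvd_iff_isRoot.mpr (by simp)) _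

/-- A pure power of `X - γ` plus a constant determines `γ`, unless the exponent is a power of the
characteristic. -/
lemma exists_eq_char_pow_of_two_centers {p : ℕ} [Fact p.Prime] [CharP F p] {D : ℕ} (hD : D ≠ 0)
    {a a' c c' γ γ' : F} (ha' : a' ≠ 0) (hne : γ ≠ γ')
    (h : C a * (X - C γ) ^ D + C c = C a' * (X - C γ') ^ D + C c') : ∃ m, D = p ^ m := by
  obtain ⟨m, d, hd, rfl⟩ := Nat.exists_eq_pow_mul_and_not_dvd hD p (Fact.out : p.Prime).ne_one
  refine ⟨m, ?_⟩
  have key : ∀ b s t : F, C b * (X - C s) ^ (p ^ m * d) + C t =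
      expand F (p ^ m) (C b * (X - C (s ^ p ^ m)) ^ d + C t) := by
    intro b s t
    simp [pow_mul, sub_pow_char_pow]
  rw [key, key] at h
  have h2 := congrArg derivative
    (expand_injective (pow_pos (Fact.out : p.Prime).pos m) h)
  have hs : γ ^ p ^ m - γ' ^ p ^ m ≠ 0 := by
    rw [← sub_pow_char_pow]
    exact pow_ne_zero _ (sub_ne_zero.mpr hne)
  have hd0 : (d : F) ≠ 0 := by rwa [Ne, CharP.cast_eq_zero_iff F p]
  rw [derivative_add, derivative_C_mul, derivative_X_sub_C_pow, derivative_add, derivative_C_mul,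
    derivative_X_sub_C_pow] at h2
  have h3 := congrArg (eval (γ ^ p ^ m)) h2
  rcases Nat.lt_or_ge 1 d with h1 | h1
  · simp [ show d - 1 ≠ 0 by lia, ha', hd0, hs] at h3
  · have : d ≠ 0 := by
      rintro rfl
      simp at hd
    rw [show d = 1 by lia, mul_one]

lemma ramIdx_eq_natDegree_unique {p : ℕ} [Fact p.Prime] [CharP F p] {q : F[X]}
    (hq : 0 < q.natDegree) (hnp : ¬ ∃ (a b : F) (m : ℕ), q = C a * X ^ p ^ m + C b) {γ γ' : F}
    (h : ramIdx q γ = q.natDegree) (h' : ramIdx q γ' = q.natDegree) : γ = γ' := by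
  by_contra hne
  obtain ⟨a, ha, hqa⟩ := exists_eq_of_ramIdx_eq_natDegree hq h
  obtain ⟨a', ha', hqa'⟩ := exists_eq_of_ramIdx_eq_natDegree hq h'
  obtain ⟨m, hm⟩ := exists_eq_char_pow_of_two_centers (p := p) hq.ne' ha' hne (hqa.symm.trans hqa')
  refine hnp ⟨a, q.eval γ - a * γ ^ p ^ m, m, ?_⟩
  conv_lhs => rw [hqa, hm, sub_pow_char_pow]
  simp only [C_sub, C_mul, C_pow]
  ring

lemma natDegree_iterPoly (q : F[X]) (n : ℕ) : (iterPoly q n).natDegree = q.natDegree ^ n := by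
  induction n with
  | zero => simp [iterPoly]
  | succ n ih => rw [iterPoly, natDegree_comp, ih, pow_succ']

lemma map_iterPoly {L : Type*} [Field L] (φ : F →+* L) (q : F[X]) (n : ℕ) :
    (iterPoly q n).map φ = iterPoly (q.map φ) n := by
  induction n with
  | zero => simp [iterPoly]
  | succ n ih => rw [iterPoly, map_comp, ih, iterPoly]

lemma ramIdx_iterPoly_succ {q : F[X]} (hq : 0 < q.natDegree) (n : ℕ) (β : F) :
    ramIdx (iterPoly q (n + 1)) β =
      ramIdx q ((iterPoly q n).eval β) * ramIdx (iterPoly q n) β :=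
  ramIdx_comp hq (by rw [natDegree_iterPoly]; exact pow_pos hq n) β

lemma ramIdx_iterPoly_zero (q : F[X]) (β : F) : ramIdx (iterPoly q 0) β = 1 := by
  simp [ramIdx, iterPoly, rootMultiplicity_X_sub_C_self]

lemma pow_le_ramIdx_iterPoly {q : F[X]} (hq : 0 < q.natDegree) {k : ℕ}
    (hk : ∀ γ, k ≤ ramIdx q γ) (n : ℕ) (β : F) : k ^ n ≤ ramIdx (iterPoly q n) β := by
  induction n with
  | zero => simp [ramIdx_iterPoly_zero]
  | succ n ih =>
    rw [ramIdx_iterPoly_succ hq, pow_succ']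
    exact Nat.mul_le_mul (hk _) ih

lemma sub_one_mul_ramIdx_iterPoly_sq_le {q : F[X]} (hq : 2 ≤ q.natDegree)
    (huniq : ∀ γ γ', ramIdx q γ = q.natDegree → ramIdx q γ' = q.natDegree → γ = γ') (n : ℕ)
    (β : F) (hcrit : ∀ γ, γ = (iterPoly q n).eval β → q.eval γ = γ → ramIdx q γ ≠ q.natDegree) :
    (q.natDegree - 1) * ramIdx (iterPoly q n) β ^ 2 ≤
      q.natDegree * (q.natDegree * (q.natDegree - 1)) ^ n := by
  have hq0 : 0 < q.natDegree := by lia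
  induction n using Nat.twoStepInduction with
  | zero => simp [ramIdx_iterPoly_zero]
  | one =>
    rw [ramIdx_iterPoly_succ hq0, ramIdx_iterPoly_zero, mul_one, pow_one]
    have := Nat.pow_le_pow_left (ramIdx_le_natDegree hq0 ((iterPoly q 0).eval β)) 2
    calc _ ≤ (q.natDegree - 1) * q.natDegree ^ 2 := Nat.mul_le_mul_left _ this
      _ = _ := by ring
  | more n ih _ =>
    set γ := (iterPoly q n).eval β with hγ
    have hev1 : (iterPoly q (n + 1)).eval β = q.eval γ := by rw [iterPoly, eval_comp]
    have hev2 : (iterPoly q (n + 2)).eval β = q.eval (q.eval γ) := by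
      rw [iterPoly, eval_comp, hev1]
    rw [hev2] at hcrit
    have hpair : ramIdx q (q.eval γ) * ramIdx q γ ≤ q.natDegree * (q.natDegree - 1) := by
      have h1 := ramIdx_le_natDegree hq0 (q.eval γ)
      have h2 := ramIdx_le_natDegree hq0 γ
      by_cases h3 : ramIdx q γ = q.natDegree
      · rw [mul_comm]
        refine Nat.mul_le_mul h2 ?_
        by_contra hlt
        have hfix := huniq _ _ h3 (show ramIdx q (q.eval γ) = q.natDegree by lia)
        exact hcrit γ (by rw [← hfix, ← hfix]) hfix.symm h3
      · exact Nat.mul_le_mul h1 (by lia)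
    have hih := ih (by
      rintro δ rfl hfix
      exact hcrit γ (by rw [hfix, hfix]) hfix)
    rw [ramIdx_iterPoly_succ hq0, ramIdx_iterPoly_succ hq0, hev1, ← hγ]
    calc _ = (ramIdx q (q.eval γ) * ramIdx q γ) ^ 2 *
          ((q.natDegree - 1) * ramIdx (iterPoly q n) β ^ 2) := by ring
      _ ≤ (q.natDegree * (q.natDegree - 1)) ^ 2 *
          (q.natDegree * (q.natDegree * (q.natDegree - 1)) ^ n) := by gcongr
      _ = _ := by ring

end Field

lemma exists_root_of_mem_irrFactors {F : Type*} [Field F] [IsAlgClosed F] {P r : F[X]}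
    (hP : P ≠ 0) (hr : r ∈ irrFactors P) :
    ∃ β, P.IsRoot β ∧ (normalizedFactors P).count r = rootMultiplicity β P := by
  have hr' : r ∈ normalizedFactors P := Multiset.mem_toFinset.mp hr
  have hirr := irreducible_of_normalized_factor r hr'
  have hnorm := normalize_normalized_factor r hr'
  have hmonic : r.Monic := by
    rw [← hnorm]
    exact monic_normalize hirr.ne_zero
  obtain ⟨β, hβ⟩ := IsAlgClosed.exists_root r
    (IsAlgClosed.degree_eq_one_of_irreducible F hirr ▸ one_ne_zero)
  have hrX : r = X - C β :=
    (eq_of_monic_of_associated (monic_X_sub_C β) hmonic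
      ((irreducible_X_sub_C β).associated_of_dvd hirr (dvd_iff_isRoot.mpr hβ))).symm
  refine ⟨β, dvd_iff_isRoot.mp (hrX ▸ dvd_of_mem_normalizedFactors hr'), ?_⟩
  have h1 := emultiplicity_eq_count_normalizedFactors hirr hP
  rw [hnorm, hrX, (finiteMultiplicity_X_sub_C β hP).emultiplicity_eq_multiplicity] at h1
  rw [hrX, rootMultiplicity_eq_multiplicity, if_neg hP]
  exact_mod_cast h1.symm

lemma irrFactors_nonempty {F : Type*} [Field F] {P : F[X]} (hP : 0 < P.natDegree) :
    (irrFactors P).Nonempty := by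
  obtain ⟨r, hr⟩ := exists_mem_normalizedFactors (x := P) (by rintro rfl; simp at hP)
    (fun hu => hP.ne' (natDegree_eq_zero_of_isUnit hu))
  exact ⟨r, Multiset.mem_toFinset.mpr hr⟩

lemma efac_mem {F : Type*} [Field F] {P : F[X]} (h : (irrFactors P).Nonempty) :
    ∃ r ∈ irrFactors P, (normalizedFactors P).count r = efac P := by
  obtain ⟨r, hr⟩ := h
  exact Nat.sInf_mem (s := {e | ∃ r ∈ irrFactors P, (normalizedFactors P).count r = e})
    ⟨_, r, hr, rfl⟩

lemma efac_le_Efac {F : Type*} [Field F] {P : F[X]} (h : (irrFactors P).Nonempty) :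
    efac P ≤ Efac P := by
  obtain ⟨r, hr, he⟩ := efac_mem h
  rw [← he]
  exact Finset.le_sup (f := fun r => (normalizedFactors P).count r) hr

lemma Efac_mem {F : Type*} [Field F] {P : F[X]} (h : (irrFactors P).Nonempty) :
    ∃ r ∈ irrFactors P, (normalizedFactors P).count r = Efac P := by
  obtain ⟨r, hr, he⟩ := Finset.exists_mem_eq_sup _ h fun r => (normalizedFactors P).count r
  exact ⟨r, hr, he.symm⟩

lemma exists_eq_monomial_add_C_of_map {K L : Type*} [Field K] [Field L] (φ : K →+* L) {g : K[X]}
    {k : ℕ} {a b : L} (hk : k ≠ 0) (h : g.map φ = C a * X ^ k + C b) :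
    ∃ a' b' : K, g = C a' * X ^ k + C b' := by
  refine ⟨g.coeff k, g.coeff 0, ?_⟩
  ext i
  have hi := congrArg (fun f : L[X] => f.coeff i) h
  simp only [coeff_map, coeff_add, coeff_C_mul, coeff_X_pow, coeff_C] at hi ⊢
  rcases eq_or_ne i k with rfl | hik
  · simp [hk]
  · rcases eq_or_ne i 0 with rfl | hi0
    · simp [hk.symm]
    · simpa [hik, hi0] using hi

end Polynomial

lemma le_sqrt_mul_sqrt_pow {D M n : ℕ} (hD : 2 ≤ D)
    (h : (D - 1) * M ^ 2 ≤ D * (D * (D - 1)) ^ n) :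
    (M : ℝ) ≤ √((D : ℝ) / ((D : ℝ) - 1)) * √((D : ℝ) * ((D : ℝ) - 1)) ^ n := by
  have hD' : (2 : ℝ) ≤ D := by exact_mod_cast hD
  have h1 : (0 : ℝ) < D - 1 := by linarith
  have h' : ((D : ℝ) - 1) * (M : ℝ) ^ 2 ≤ D * (D * (D - 1)) ^ n := by
    have := (Nat.cast_le (α := ℝ)).mpr h
    push_cast [Nat.cast_sub (show 1 ≤ D by lia)] at this
    exact this
  refine abs_le_of_sq_le_sq' ?_ (by positivity) |>.2
  rw [mul_pow, ← pow_mul, mul_comm n 2, pow_mul, Real.sq_sqrt (by positivity),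
    Real.sq_sqrt (by positivity), div_mul_eq_mul_div, le_div_iff₀ h1]
  linarith

theorem stmt14 {K : Type*} [Field K] [Fintype K] {p : ℕ} [Fact p.Prime] [CharP K p]
    (g G : Polynomial K) (h D : ℕ)
    (hgD : g.natDegree = D) (hD : 2 ≤ D)
    (hred : g = G ^ p ^ h) (hG : derivative G ≠ 0)
    (α : AlgebraicClosure K)
    (hform1 : ¬ ∃ (a b : K) (m : ℕ), g = C a * X ^ p ^ m + C b)
    (hform2 : ¬ ∃ a : AlgebraicClosure K,
      g.map (algebraMap K (AlgebraicClosure K)) = C a * (X - C α) ^ D + C α) :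
    ∀ n : ℕ,
      (p : ℝ) ^ (n * h) ≤
        (efac ((iterPoly g n).map (algebraMap K (AlgebraicClosure K)) - C α) : ℝ) ∧
      (efac ((iterPoly g n).map (algebraMap K (AlgebraicClosure K)) - C α) : ℝ) ≤
        (Efac ((iterPoly g n).map (algebraMap K (AlgebraicClosure K)) - C α) : ℝ) ∧
      (Efac ((iterPoly g n).map (algebraMap K (AlgebraicClosure K)) - C α) : ℝ) ≤
        Real.sqrt ((D : ℝ) / ((D : ℝ) - 1)) * Real.sqrt ((D : ℝ) * ((D : ℝ) - 1)) ^ n ∧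
      Real.sqrt ((D : ℝ) / ((D : ℝ) - 1)) * Real.sqrt ((D : ℝ) * ((D : ℝ) - 1)) ^ n ≤
        Real.sqrt 2 * Real.sqrt ((D : ℝ) * ((D : ℝ) - 1)) ^ n := by
  intro n
  have : CharP (AlgebraicClosure K) p :=
    charP_of_injective_algebraMap (algebraMap K (AlgebraicClosure K)).injective p
  have hp : p.Prime := Fact.out
  set q := g.map (algebraMap K (AlgebraicClosure K)) with hq
  have hqD : q.natDegree = D := by rw [hq, natDegree_map, hgD]
  have hq0 : 0 < q.natDegree := by lia
  have hqnp : ¬ ∃ (a b : AlgebraicClosure K) (m : ℕ), q = C a * X ^ p ^ m + C b := by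
    rintro ⟨a, b, m, hab⟩
    obtain ⟨a', b', h'⟩ := exists_eq_monomial_add_C_of_map _ (pow_pos hp.pos m).ne' hab
    exact hform1 ⟨a', b', m, h'⟩
  have huniq : ∀ γ γ', ramIdx q γ = q.natDegree → ramIdx q γ' = q.natDegree → γ = γ' :=
    fun γ γ' => ramIdx_eq_natDegree_unique hq0 hqnp
  have hlow : ∀ γ, p ^ h ≤ ramIdx q γ := by
    have hqG : q = (G.map (algebraMap K (AlgebraicClosure K))) ^ p ^ h := by
      rw [hq, hred, Polynomial.map_pow]
    rw [hqG] at hq0 ⊢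
    exact le_ramIdx_pow_char_pow hq0
  have hcrit : ∀ γ, γ = α → q.eval γ = γ → ramIdx q γ ≠ q.natDegree := by
    rintro γ rfl hfix hram
    obtain ⟨a, -, ha⟩ := exists_eq_of_ramIdx_eq_natDegree hq0 hram
    rw [hfix, hqD] at ha
    exact hform2 ⟨a, ha⟩
  rw [map_iterPoly, ← hq]
  have hPdeg : 0 < (iterPoly q n - C α).natDegree := by
    rw [natDegree_sub_C, natDegree_iterPoly]
    exact pow_pos hq0 n
  have hP0 : iterPoly q n - C α ≠ 0 := by
    intro h0
    simp [h0] at hPdeg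
  have hne := irrFactors_nonempty hPdeg
  have hroot : ∀ r ∈ irrFactors (iterPoly q n - C α), ∃ β, (iterPoly q n).eval β = α ∧
      (normalizedFactors (iterPoly q n - C α)).count r = ramIdx (iterPoly q n) β := by
    intro r hr
    obtain ⟨β, hβ, he⟩ := exists_root_of_mem_irrFactors hP0 hr
    have hβ' : (iterPoly q n).eval β = α := by simpa [sub_eq_zero] using hβ
    exact ⟨β, hβ', by rw [he, ramIdx, hβ']⟩
  refine ⟨?_, by exact_mod_cast efac_le_Efac hne, ?_, ?_⟩
  · obtain ⟨r, hr, he⟩ := efac_mem hne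
    obtain ⟨β, -, hβ⟩ := hroot r hr
    rw [← he, hβ, mul_comm n h, pow_mul]
    exact_mod_cast pow_le_ramIdx_iterPoly hq0 hlow n β
  · obtain ⟨r, hr, he⟩ := Efac_mem hne
    obtain ⟨β, hβα, hβ⟩ := hroot r hr
    rw [← he, hβ]
    refine le_sqrt_mul_sqrt_pow hD ?_
    rw [← hqD]
    exact sub_one_mul_ramIdx_iterPoly_sq_le (hqD ▸ hD) huniq n β (hβα ▸ hcrit)
  · have hD' : (2 : ℝ) ≤ D := by exact_mod_cast hD
    gcongr
    rw [div_le_iff₀ (by linarith)]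
    linarith
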